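/- Suppose T and each T_i (i = 1,…,m) are compact operators with closed range, the only v ∈ 0⁺F with ⟨v, T v⟩ = 0 is v = 0, the constraint set F is nonempty, and f is bounded from below on F. Then f attains its infimum on F. -/

import Mathlib

open scoped RealInnerProductSpace
open Filter Topology

/-- A sequence `x` in a real inner product space converges weakly to `x₀` if
`⟪a, x k⟫ → ⟪a, x₀⟫` for every `a`. -/
def WeaklyConvergesTo {H : Type*} [NormedAddCommGroup H] [InnerProductSpace ℝ H]
    (x : ℕ → H) (x₀ : H) : Prop :=
  ∀ a : H, Tendsto (fun k => ⟪a, x k⟫) atTop (𝓝 ⟪a, x₀⟫)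

/-- The recession cone `0⁺X = {v | x + t • v ∈ X for all x ∈ X and t ≥ 0}`. -/
def recessionCone {H : Type*} [NormedAddCommGroup H] [InnerProductSpace ℝ H]
    (X : Set H) : Set H :=
  {v | ∀ x ∈ X, ∀ t : ℝ, 0 ≤ t → x + t • v ∈ X}

/-- A (continuous linear) operator is compact if it maps every weakly convergent sequence
to a strongly convergent sequence. -/
def CompactOp {H : Type*} [NormedAddCommGroup H] [InnerProductSpace ℝ H]
    (A : H →L[ℝ] H) : Prop :=
  ∀ (x : ℕ → H) (x₀ : H), WeaklyConvergesTo x x₀ →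
    Tendsto (fun k => A (x k)) atTop (𝓝 (A x₀))

/-- An infinite-dimensional real Hilbert space contains an orthonormal sequence. -/
theorem exists_orthonormal_nat {K : Type*} [NormedAddCommGroup K] [InnerProductSpace ℝ K]
    [CompleteSpace K] (hK : ¬ FiniteDimensional ℝ K) : ∃ e : ℕ → K, Orthonormal ℝ e := by
  obtain ⟨w, b, -⟩ := exists_hilbertBasis ℝ K
  have hw : Infinite w := by
    by_contra h
    rw [not_infinite_iff_finite] at h
    have := Fintype.ofFinite w
    exact hK b.toOrthonormalBasis.toBasis.finiteDimensional_of_finite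
  exact ⟨b ∘ Infinite.natEmbedding w, b.orthonormal.comp _ (Infinite.natEmbedding w).injective⟩

/-- Orthonormal sequences converge weakly to zero. -/
theorem Orthonormal.weaklyConvergesTo_zero {H : Type*} [NormedAddCommGroup H]
    [InnerProductSpace ℝ H] {e : ℕ → H} (he : Orthonormal ℝ e) : WeaklyConvergesTo e 0 := by
  intro a
  have h := (he.inner_products_summable (x := a)).tendsto_atTop_zero.sqrt
  rw [inner_zero_right, tendsto_zero_iff_norm_tendsto_zero]
  simpa [Real.sqrt_sq_eq_abs, real_inner_comm] using h

/-- A compact operator with closed range has finite rank. -/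
theorem CompactOp.finiteDimensional_range {H : Type*} [NormedAddCommGroup H]
    [InnerProductSpace ℝ H] [CompleteSpace H] {A : H →L[ℝ] H} (hA : CompactOp A)
    (hr : IsClosed (Set.range fun x => A x)) :
    FiniteDimensional ℝ (LinearMap.range (A : H →ₗ[ℝ] H)) := by
  set K : Submodule ℝ H := (LinearMap.ker (A : H →ₗ[ℝ] H))ᗮ
  have : CompleteSpace (LinearMap.ker (A : H →ₗ[ℝ] H)) := A.isClosed_ker.completeSpace_coe
  have hrange : ∀ x : H, ∃ y : K, A y = A x := fun x => by
    obtain ⟨y, hy, z, hz, rfl⟩ :=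
      (LinearMap.ker (A : H →ₗ[ℝ] H)).exists_add_mem_mem_orthogonal x
    have hy' : A y = 0 := hy
    exact ⟨⟨z, hz⟩, by simp [hy']⟩
  set B : K →L[ℝ] H := A ∘L K.subtypeL with hB
  have hBr : Set.range B = Set.range fun x => A x := by
    ext y
    constructor
    · rintro ⟨x, rfl⟩
      exact ⟨x, rfl⟩
    · rintro ⟨x, rfl⟩
      exact hrange x
  have hBi : Function.Injective B := by
    rw [injective_iff_map_eq_zero]
    rintro ⟨x, hx⟩ h
    have hx0 : x ∈ LinearMap.ker (A : H →ₗ[ℝ] H) := h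
    have := hx x hx0
    simpa using this
  obtain ⟨C, hC⟩ := B.antilipschitz_of_injective_of_isClosed_range hBi (hBr ▸ hr)
  have hfin : FiniteDimensional ℝ K := by
    by_contra hinf
    obtain ⟨e, he⟩ := exists_orthonormal_nat hinf
    have he' : Orthonormal ℝ (fun n => (e n : H)) := he.comp_linearIsometry K.subtypeₗᵢ
    have h0 := hA _ _ he'.weaklyConvergesTo_zero
    rw [map_zero] at h0
    have h1 : Tendsto (fun n => C * ‖A (e n)‖) atTop (𝓝 (C * 0)) := by
      simpa using h0.norm.const_mul (C : ℝ)
    have h2 : ∀ n, 1 ≤ C * ‖A (e n)‖ := fun n => by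
      have := hC.le_mul_norm_sub (e n) 0
      simpa [he.1 n, hB] using this
    have := ge_of_tendsto' h1 h2
    norm_num at this
  have hle : LinearMap.range (A : H →ₗ[ℝ] H) ≤ LinearMap.range (B : K →ₗ[ℝ] H) := by
    rintro _ ⟨x, rfl⟩
    exact hrange x
  exact Submodule.finiteDimensional_of_le hle

/-- A positive semidefinite symmetric operator vanishes where its quadratic form does. -/
theorem eq_zero_of_inner_map_self_eq_zero {H : Type*} [NormedAddCommGroup H]
    [InnerProductSpace ℝ H] {A : H →L[ℝ] H} (hsa : ∀ x y : H, ⟪A x, y⟫ = ⟪x, A y⟫)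
    (hpos : ∀ x : H, 0 ≤ ⟪x, A x⟫) {v : H} (hv : ⟪v, A v⟫ = 0) : A v = 0 := by
  have key : ∀ s : ℝ, 0 ≤ ⟪A v, A (A v)⟫ * (s * s) + (2 * ⟪A v, A v⟫) * s + 0 := fun s => by
    have h := hpos (v + s • A v)
    simp only [map_add, map_smul, inner_add_left, inner_add_right, real_inner_smul_left,
      real_inner_smul_right, hv, ← hsa v (A v)] at h
    linarith
  have hd := discrim_le_zero key
  rw [discrim] at hd
  have : ⟪A v, A v⟫ = 0 := by nlinarith [sq_nonneg ⟪A v, A v⟫]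
  exact inner_self_eq_zero.mp this

/-- Along `rₙ • uₙ` with `rₙ → ∞` and `uₙ → v`, a quadratic function divided by `rₙ²` tends to
its leading form at `v`. -/
theorem tendsto_quadratic_div_sq {H : Type*} [NormedAddCommGroup H] [InnerProductSpace ℝ H]
    (A : H →L[ℝ] H) (c : H) (a : ℝ) {r : ℕ → ℝ} {u : ℕ → H} {v : H}
    (hr : Tendsto r atTop atTop) (hu : Tendsto u atTop (𝓝 v)) :
    Tendsto (fun n => ((1/2 : ℝ) * ⟪r n • u n, A (r n • u n)⟫ + ⟪c, r n • u n⟫ + a) / r n ^ 2)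
      atTop (𝓝 ((1/2 : ℝ) * ⟪v, A v⟫)) := by
  have hi := hr.inv_tendsto_atTop
  have hq : Tendsto (fun n => ⟪u n, A (u n)⟫) atTop (𝓝 ⟪v, A v⟫) :=
    hu.inner ((A.continuous.tendsto v).comp hu)
  have hl : Tendsto (fun n => ⟪c, u n⟫) atTop (𝓝 ⟪c, v⟫) := tendsto_const_nhds.inner hu
  have h := ((hq.const_mul (1/2 : ℝ)).add (hi.mul hl)).add ((hi.mul hi).mul_const a)
  simp only [zero_mul, add_zero] at h
  refine h.congr' ?_
  filter_upwards [hr.eventually_gt_atTop 0] with n hn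
  simp only [map_smul, real_inner_smul_left, real_inner_smul_right, Pi.inv_apply]
  field_simp

/-- A limit direction of an unbounded sequence in the sublevel set of a convex quadratic function
is annihilated by the operator and is a direction of nonincrease for the linear part. -/
theorem map_eq_zero_and_inner_nonpos_of_tendsto {H : Type*} [NormedAddCommGroup H]
    [InnerProductSpace ℝ H] {A : H →L[ℝ] H} (hsa : ∀ x y : H, ⟪A x, y⟫ = ⟪x, A y⟫)
    (hpos : ∀ x : H, 0 ≤ ⟪x, A x⟫) {c : H} {a : ℝ} {r : ℕ → ℝ} {u : ℕ → H} {v : H}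
    (hr : Tendsto r atTop atTop) (hu : Tendsto u atTop (𝓝 v))
    (h : ∀ n, (1/2 : ℝ) * ⟪r n • u n, A (r n • u n)⟫ + ⟪c, r n • u n⟫ + a ≤ 0) :
    A v = 0 ∧ ⟪c, v⟫ ≤ 0 := by
  constructor
  · refine eq_zero_of_inner_map_self_eq_zero hsa hpos (le_antisymm ?_ (hpos v))
    have := le_of_tendsto' (tendsto_quadratic_div_sq A c a hr hu)
      fun n => div_nonpos_of_nonpos_of_nonneg (h n) (sq_nonneg _)
    linarith
  · have hl : Tendsto (fun n => ⟪c, u n⟫ + (r n)⁻¹ * a) atTop (𝓝 (⟪c, v⟫ + 0 * a)) :=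
      (tendsto_const_nhds.inner hu).add (hr.inv_tendsto_atTop.mul_const a)
    rw [zero_mul, add_zero] at hl
    refine le_of_tendsto hl ?_
    filter_upwards [hr.eventually_gt_atTop 0] with n hn
    have h1 := h n
    rw [real_inner_smul_right c] at h1
    have h2 := hpos (r n • u n)
    have h3 : r n * (⟪c, u n⟫ + (r n)⁻¹ * a) ≤ 0 := by
      rw [mul_add, mul_inv_cancel_left₀ hn.ne']
      linarith
    exact nonpos_of_mul_nonpos_right h3 hn

/-- Directions annihilated by all the operators along which no linear part increases are
recession directions of the feasible set of convex quadratic constraints. -/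
theorem mem_recessionCone_of_map_eq_zero {H ι : Type*} [NormedAddCommGroup H]
    [InnerProductSpace ℝ H] {A : ι → H →L[ℝ] H} (hsa : ∀ i, ∀ x y : H, ⟪A i x, y⟫ = ⟪x, A i y⟫)
    {c : ι → H} {a : ι → ℝ} {v : H} (hA : ∀ i, A i v = 0) (hc : ∀ i, ⟪c i, v⟫ ≤ 0) :
    v ∈ recessionCone {x : H | ∀ i, (1/2 : ℝ) * ⟪x, A i x⟫ + ⟪c i, x⟫ + a i ≤ 0} := by
  intro x hx t ht i
  have h1 : ⟪v, A i x⟫ = 0 := by rw [← hsa, hA, inner_zero_left]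
  simp only [map_add, map_smul, hA, smul_zero, add_zero, inner_add_left, inner_add_right,
    real_inner_smul_left, real_inner_smul_right, h1, mul_zero]
  have := mul_nonpos_of_nonneg_of_nonpos ht (hc i)
  linarith [hx i]

/-- If `T` and all `Tᵢ` are compact with closed range, the only `v ∈ 0⁺F` with
`⟪v, T v⟫ = 0` is `v = 0`, `F` is nonempty and `f` is bounded from below on `F`, then `f`
attains its infimum on `F`. -/
theorem compact_trivial_recession
    {H : Type*} [NormedAddCommGroup H] [InnerProductSpace ℝ H] [CompleteSpace H]
    {m : ℕ} (T : H →L[ℝ] H) (hT_sa : ∀ x y : H, ⟪T x, y⟫ = ⟪x, T y⟫) (c : H)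
    (Ti : Fin m → H →L[ℝ] H)
    (hTi_sa : ∀ i, ∀ x y : H, ⟪Ti i x, y⟫ = ⟪x, Ti i y⟫)
    (hTi_pos : ∀ i, ∀ x : H, 0 ≤ ⟪x, Ti i x⟫)
    (ci : Fin m → H) (α : Fin m → ℝ)
    (f : H → ℝ) (hf : ∀ x, f x = (1/2 : ℝ) * ⟪x, T x⟫ + ⟪c, x⟫)
    (F : Set H)
    (hF : F = {x : H | ∀ i, (1/2 : ℝ) * ⟪x, Ti i x⟫ + ⟪ci i, x⟫ + α i ≤ 0})
    (hTc : CompactOp T) (hTr : IsClosed (Set.range fun x => T x))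
    (hTic : ∀ i, CompactOp (Ti i))
    (hTir : ∀ i, IsClosed (Set.range fun x => Ti i x))
    (hrec : ∀ v ∈ recessionCone F, ⟪v, T v⟫ = 0 → v = 0)
    (hne : F.Nonempty) (hbd : BddBelow (f '' F)) :
    ∃ xbar ∈ F, ∀ x ∈ F, f xbar ≤ f x := by
  subst hF
  have hfin : FiniteDimensional ℝ H := by
    have := hTc.finiteDimensional_range hTr
    have := fun i => (hTic i).finiteDimensional_range (hTir i)
    let Φ : H →ₗ[ℝ] LinearMap.range (T : H →ₗ[ℝ] H) ×
        (∀ i, LinearMap.range (Ti i : H →ₗ[ℝ] H)) × (Fin m → ℝ) :=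
      (T : H →ₗ[ℝ] H).rangeRestrict.prod
        ((LinearMap.pi fun i => (Ti i : H →ₗ[ℝ] H).rangeRestrict).prod
          (LinearMap.pi fun i => (innerSL ℝ (ci i) : H →ₗ[ℝ] ℝ)))
    refine Module.Finite.of_injective Φ ((injective_iff_map_eq_zero Φ).2 fun v hv => ?_)
    obtain ⟨h1, h2⟩ := Prod.ext_iff.1 hv
    obtain ⟨h2, h3⟩ := Prod.ext_iff.1 h2
    have h1 : T v = 0 := congrArg Subtype.val h1
    have h2 : ∀ i, Ti i v = 0 := fun i => congrArg Subtype.val (congrFun h2 i)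
    have h3 : ∀ i, ⟪ci i, v⟫ = 0 := fun i => congrFun h3 i
    exact hrec v (mem_recessionCone_of_map_eq_zero hTi_sa h2 fun i => (h3 i).le) (by simp [h1])
  have hfc : Continuous f := by
    rw [funext hf]
    fun_prop
  set F : Set H := {x : H | ∀ i, (1/2 : ℝ) * ⟪x, Ti i x⟫ + ⟪ci i, x⟫ + α i ≤ 0} with hF
  have hFc : IsClosed F := by
    rw [hF, Set.ofPred_forall]
    exact isClosed_iInter fun i => isClosed_le (by fun_prop) continuous_const
  obtain ⟨x₀, hx₀⟩ := hne
  obtain ⟨B, hB⟩ := hbd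
  have hSc : IsClosed (F ∩ {x | f x ≤ f x₀}) := hFc.inter (isClosed_le hfc continuous_const)
  have hSb : Bornology.IsBounded (F ∩ {x | f x ≤ f x₀}) := by
    by_contra hub
    have hub' : ∀ n : ℕ, ∃ x ∈ F ∩ {x | f x ≤ f x₀}, (n : ℝ) < ‖x‖ := by
      intro n
      by_contra! hn
      exact hub (isBounded_iff_forall_norm_le.2 ⟨n, hn⟩)
    choose x hxS hxn using hub'
    have hx0 : ∀ n, ‖x n‖ ≠ 0 := fun n => (n.cast_nonneg.trans_lt (hxn n)).ne'
    have hsphere : ∀ n, ‖x n‖⁻¹ • x n ∈ Metric.sphere (0 : H) 1 := fun n => by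
      simp [norm_smul, hx0 n]
    obtain ⟨v, hv, φ, hφ, hlim⟩ := (isCompact_sphere (0 : H) 1).tendsto_subseq hsphere
    have hr : Tendsto (fun n => ‖x (φ n)‖) atTop atTop :=
      (tendsto_atTop_mono (fun n => (hxn n).le) tendsto_natCast_atTop_atTop).comp hφ.tendsto_atTop
    have hxu : ∀ n, ‖x (φ n)‖ • ((fun n => ‖x n‖⁻¹ • x n) ∘ φ) n = x (φ n) := fun n =>
      smul_inv_smul₀ (hx0 _) _
    have hdir : ∀ i, Ti i v = 0 ∧ ⟪ci i, v⟫ ≤ 0 := fun i =>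
      map_eq_zero_and_inner_nonpos_of_tendsto (hTi_sa i) (hTi_pos i) (a := α i) hr hlim
        fun n => by
          rw [hxu]
          exact (hxS (φ n)).1 i
    have hvrec : v ∈ recessionCone F :=
      mem_recessionCone_of_map_eq_zero hTi_sa (fun i => (hdir i).1) fun i => (hdir i).2
    have hq := tendsto_quadratic_div_sq T c 0 hr hlim
    simp only [hxu, add_zero, ← hf] at hq
    have hr2 : Tendsto (fun n => ‖x (φ n)‖ ^ 2) atTop atTop :=
      (tendsto_pow_atTop two_ne_zero).comp hr
    have hq0 : Tendsto (fun n => f (x (φ n)) / ‖x (φ n)‖ ^ 2) atTop (𝓝 0) :=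
      tendsto_of_tendsto_of_tendsto_of_le_of_le (hr2.const_div_atTop B)
        (hr2.const_div_atTop (f x₀))
        (fun n => div_le_div_of_nonneg_right (hB ⟨_, (hxS (φ n)).1, rfl⟩) (sq_nonneg _))
        (fun n => div_le_div_of_nonneg_right (hxS (φ n)).2 (sq_nonneg _))
    have hv0 : v = 0 := hrec v hvrec (by linarith [tendsto_nhds_unique hq hq0])
    simp [hv0] at hv
  obtain ⟨y, hy, hmin⟩ := (Metric.isCompact_of_isClosed_isBounded hSc hSb).exists_isMinOn
    ⟨x₀, hx₀, le_refl (f x₀)⟩ hfc.continuousOn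
  refine ⟨y, hy.1, fun x hx => ?_⟩
  rcases le_total (f x) (f x₀) with h | h
  · exact hmin ⟨hx, h⟩
  · exact hy.2.trans h
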